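/- For all integers k and r with k > r ≥ 1, the pair of sequences (α_n, β_n) defined by α_0 = 1, α_n = (−1)^n q^{(k−r)n²} (q^{(k−r−1)n} + q^{−(k−r)n}) (1+q^n)/2 for n ≥ 1, and β_n = Σ_{n ≥ N_{r+1} ≥ N_{r+2} ≥ ⋯ ≥ N_{k−1} ≥ 0} (1+q^n) q^{N_{r+1}²+⋯+N_{k−1}²+N_{r+1}+⋯+N_{k−1}} / ( 2 (q;q)_{n−N_{r+1}} (q;q)_{N_{r+1}−N_{r+2}} ⋯ (q;q)_{N_{k−2}−N_{k−1}} (q²;q²)_{N_{k−1}} ), where for r = k−1 there are no summation variables and β_n = (1+q^n)/(2 (q²;q²)_n), is a Bailey pair relative to (1,q). -/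

import Mathlib

open scoped Classical

noncomputable section

/-- The field `ℚ((q))` of formal Laurent series over `ℚ`. -/
abbrev F := LaurentSeries ℚ

/-- The formal variable `q`. -/
def qq : F := HahnSeries.single 1 1

/-- The finite `q`-Pochhammer symbol `(a;b)_m = ∏_{i<m} (1 - a bⁱ)`. -/
def qp (a b : F) (m : ℕ) : F := ∏ i ∈ Finset.range m, (1 - a * b ^ i)

/-- The finite set of weakly decreasing `t`-tuples of naturals bounded by `b`. -/
def decTuples (t b : ℕ) : Finset (Fin t → ℕ) :=
  (Fintype.piFinset fun _ => Finset.range (b + 1)).filter fun N =>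
    ∀ i j : Fin t, i ≤ j → N j ≤ N i

/-- The chain `n = f 0 ≥ f 1 = N 0 ≥ f 2 = N 1 ≥ ⋯` (value `0` beyond `t`). -/
def chain (t n : ℕ) (N : Fin t → ℕ) (i : ℕ) : ℕ :=
  if i = 0 then n else if h : i - 1 < t then N ⟨i - 1, h⟩ else 0

lemma qq_ne_zero : qq ≠ 0 := by
  simp [qq]

lemma one_sub_qq_pow_ne_zero (n : ℕ) : 1 - qq ^ (n + 1) ≠ 0 := by
  intro h
  have h0 := congrArg (fun f : F => f.coeff 0) h
  have hn : (0 : ℤ) ≠ (n : ℤ) + 1 := by omega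
  simp [qq, HahnSeries.single_pow, HahnSeries.coeff_single_of_ne hn] at h0

/-- The reciprocal `1 / (q;q)_z`, with the usual convention that it vanishes for `z < 0`. -/
def recipPoch (z : ℤ) : F := if z < 0 then 0 else (qp qq qq z.toNat)⁻¹

lemma recipPoch_of_neg {z : ℤ} (hz : z < 0) : recipPoch z = 0 := if_pos hz

lemma recipPoch_natCast (n : ℕ) : recipPoch n = (qp qq qq n)⁻¹ := by
  simp [recipPoch]

lemma recipPoch_sub_one (z : ℤ) : recipPoch (z - 1) = (1 - qq ^ z) * recipPoch z := by
  rcases lt_trichotomy z 0 with hz | rfl | hz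
  · rw [recipPoch_of_neg hz, recipPoch_of_neg (by omega), mul_zero]
  · simp [recipPoch]
  · obtain ⟨n, rfl⟩ : ∃ n : ℕ, z = (n + 1 : ℕ) := ⟨(z - 1).toNat, by omega⟩
    have h := one_sub_qq_pow_ne_zero n
    rw [show ((n + 1 : ℕ) : ℤ) - 1 = n by push_cast; ring, recipPoch_natCast, recipPoch_natCast,
      zpow_natCast, qp, qp, Finset.prod_range_succ, ← pow_succ', mul_inv, mul_left_comm,
      mul_inv_cancel₀ h, mul_one]

/-- A limiting case of the `q`-Chu–Vandermonde sum. -/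
lemma sum_recipPoch_vandermonde (N c : ℕ) :
    ∑ j ∈ Finset.range (N + 1),
      qq ^ (j ^ 2 + c * j) * recipPoch (N - j) * recipPoch j * recipPoch (j + c) =
    recipPoch N * recipPoch (N + c) := by
  have hq := qq_ne_zero
  induction N generalizing c with
  | zero => simp [recipPoch, qp]
  | succ N ih =>
    have hN := one_sub_qq_pow_ne_zero N
    have key : ∀ j : ℕ, (1 - qq ^ (N + 1)) * (qq ^ (j ^ 2 + c * j) *
        recipPoch ((N + 1 : ℕ) - j) * recipPoch j * recipPoch (j + c)) =
        qq ^ (j ^ 2 + c * j) * recipPoch ((N + 1 : ℕ) - j) * recipPoch (j - 1) *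
          recipPoch (j + c) +
        qq ^ (j ^ 2 + c * j + j) * recipPoch (N - j) * recipPoch j * recipPoch (j + c) := by
      intro j
      have h1 := recipPoch_sub_one j
      have h2 := recipPoch_sub_one ((N + 1 : ℕ) - j)
      rw [show ((N + 1 : ℕ) : ℤ) - j - 1 = N - j by push_cast; ring] at h2
      rw [h1, h2, zpow_sub₀ hq, zpow_natCast, zpow_natCast]
      field_simp
      ring
    have key' : ∀ j : ℕ,
        qq ^ ((j + 1) ^ 2 + c * (j + 1)) * recipPoch ((N + 1 : ℕ) - (j + 1 : ℕ)) *
          recipPoch ((j + 1 : ℕ) - 1) * recipPoch ((j + 1 : ℕ) + c) +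
        qq ^ (j ^ 2 + c * j + j) * recipPoch (N - j) * recipPoch j * recipPoch (j + c) =
        qq ^ (j ^ 2 + (c + 1) * j) * recipPoch (N - j) * recipPoch j *
          recipPoch (j + (c + 1 : ℕ)) := by
      intro j
      have h1 := recipPoch_sub_one (j + (c + 1 : ℕ))
      rw [show (j : ℤ) + (c + 1 : ℕ) - 1 = j + c by push_cast; ring] at h1
      rw [show ((N + 1 : ℕ) : ℤ) - (j + 1 : ℕ) = N - j by push_cast; ring,
        show ((j + 1 : ℕ) : ℤ) - 1 = j by push_cast; ring,
        show ((j + 1 : ℕ) : ℤ) + c = j + (c + 1 : ℕ) by push_cast; ring, h1,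
        zpow_add₀ hq, zpow_natCast, zpow_natCast]
      ring
    have hN1 := recipPoch_sub_one (N + 1 : ℕ)
    rw [show ((N + 1 : ℕ) : ℤ) - 1 = N by push_cast; ring, zpow_natCast] at hN1
    apply mul_left_cancel₀ hN
    rw [Finset.mul_sum, Finset.sum_congr rfl fun j _ => key j, Finset.sum_add_distrib,
      Finset.sum_range_succ', Finset.sum_range_succ _ (N + 1)]
    rw [recipPoch_of_neg (z := ((0 : ℕ) : ℤ) - 1) (by simp),
      recipPoch_of_neg (z := (N : ℤ) - (N + 1 : ℕ)) (by push_cast; omega)]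
    simp only [mul_zero, zero_mul, add_zero]
    rw [← Finset.sum_add_distrib, Finset.sum_congr rfl fun j _ => key' j, ih (c + 1), hN1,
      show ((N + 1 : ℕ) : ℤ) + c = N + (c + 1 : ℕ) by push_cast; ring]
    ring

/-- The summation underlying Bailey's lemma relative to `(q,q)`. -/
lemma sum_recipPoch_bailey {n ρ : ℕ} (h : ρ ≤ n) :
    ∑ m ∈ Finset.range (n + 1),
      qq ^ (m ^ 2 + m) * recipPoch (n - m) * (recipPoch (m - ρ) * recipPoch (m + ρ + 1)) =
    qq ^ (ρ ^ 2 + ρ) * (recipPoch (n - ρ) * recipPoch (n + ρ + 1)) := by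
  obtain ⟨N, rfl⟩ := Nat.exists_eq_add_of_le h
  rw [add_assoc, Finset.sum_range_add, Finset.sum_eq_zero, zero_add]
  · have hV := sum_recipPoch_vandermonde N (2 * ρ + 1)
    rw [show ((ρ + N : ℕ) : ℤ) - ρ = N by push_cast; ring,
      show ((ρ + N : ℕ) : ℤ) + ρ + 1 = N + (2 * ρ + 1 : ℕ) by push_cast; ring, ← hV,
      Finset.mul_sum]
    refine Finset.sum_congr rfl fun j _ => ?_
    rw [show ((ρ + N : ℕ) : ℤ) - (ρ + j : ℕ) = N - j by push_cast; ring,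
      show ((ρ + j : ℕ) : ℤ) - ρ = j by push_cast; ring,
      show ((ρ + j : ℕ) : ℤ) + ρ + 1 = j + (2 * ρ + 1 : ℕ) by push_cast; ring]
    ring
  · intro m hm
    rw [recipPoch_of_neg (z := (m : ℤ) - ρ) (by have := Finset.mem_range.1 hm; omega)]
    ring

/-- The summand of the `(q,q)`-relative Bailey pair, including the kernel. -/
def baileyTerm (d n ρ : ℕ) : F :=
  (-1) ^ ρ * qq ^ ((d + 1) * ρ ^ 2 + d * ρ) * (1 - qq ^ (2 * ρ + 1)) *
    (recipPoch (n - ρ) * recipPoch (n + ρ + 1))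

lemma baileyTerm_of_lt {d n ρ : ℕ} (h : n < ρ) : baileyTerm d n ρ = 0 := by
  rw [baileyTerm, recipPoch_of_neg (z := (n : ℤ) - ρ) (by omega)]
  ring

lemma sum_baileyTerm_extend {d m n : ℕ} (h : m ≤ n) :
    ∑ ρ ∈ Finset.range (m + 1), baileyTerm d m ρ =
      ∑ ρ ∈ Finset.range (n + 1), baileyTerm d m ρ := by
  refine Finset.sum_subset (Finset.range_subset_range.2 (by omega)) fun ρ _ hρ => baileyTerm_of_lt ?_
  exact Nat.lt_of_succ_le (Nat.le_of_not_lt fun h => hρ (Finset.mem_range.2 h))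

/-- The unit step of Bailey's chain relative to `(q,q)`. -/
lemma sum_baileyTerm_succ (d n : ℕ) :
    ∑ m ∈ Finset.range (n + 1), qq ^ (m ^ 2 + m) * recipPoch (n - m) *
      ∑ ρ ∈ Finset.range (m + 1), baileyTerm d m ρ =
    ∑ ρ ∈ Finset.range (n + 1), baileyTerm (d + 1) n ρ := by
  calc
    _ = ∑ m ∈ Finset.range (n + 1), ∑ ρ ∈ Finset.range (n + 1),
          qq ^ (m ^ 2 + m) * recipPoch (n - m) * baileyTerm d m ρ := by
      refine Finset.sum_congr rfl fun m hm => ?_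
      rw [sum_baileyTerm_extend (Nat.lt_succ_iff.1 (Finset.mem_range.1 hm)), Finset.mul_sum]
    _ = ∑ ρ ∈ Finset.range (n + 1), ∑ m ∈ Finset.range (n + 1),
          qq ^ (m ^ 2 + m) * recipPoch (n - m) * baileyTerm d m ρ := Finset.sum_comm
    _ = _ := by
      refine Finset.sum_congr rfl fun ρ hρ => ?_
      have h := sum_recipPoch_bailey (Nat.lt_succ_iff.1 (Finset.mem_range.1 hρ))
      calc
        _ = (-1) ^ ρ * qq ^ ((d + 1) * ρ ^ 2 + d * ρ) * (1 - qq ^ (2 * ρ + 1)) *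
            ∑ m ∈ Finset.range (n + 1), qq ^ (m ^ 2 + m) * recipPoch (n - m) *
              (recipPoch (m - ρ) * recipPoch (m + ρ + 1)) := by
          rw [Finset.mul_sum]
          refine Finset.sum_congr rfl fun m _ => ?_
          rw [baileyTerm]
          ring
        _ = _ := by
          rw [h, baileyTerm]
          ring

lemma sum_baileyTerm_zero_succ (n : ℕ) :
    (1 - qq ^ (2 * (n + 1))) * ∑ ρ ∈ Finset.range (n + 2), baileyTerm 0 (n + 1) ρ =
      ∑ ρ ∈ Finset.range (n + 1), baileyTerm 0 n ρ := by
  have hq := qq_ne_zero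
  let H : ℕ → F := fun ρ => (-1) ^ ρ * qq ^ (ρ ^ 2) * qq ^ (n + 1) *
    (qq ^ ρ - (qq ^ ρ)⁻¹) * (recipPoch (n + 1 - ρ) * recipPoch (n + 1 + ρ))
  have key : ∀ ρ : ℕ, (1 - qq ^ (2 * (n + 1))) * baileyTerm 0 (n + 1) ρ - baileyTerm 0 n ρ =
      H (ρ + 1) - H ρ := by
    intro ρ
    have h1 := recipPoch_sub_one (n + 1 - ρ)
    have h2 := recipPoch_sub_one (n + 1 + ρ + 1)
    rw [show (n : ℤ) + 1 - ρ - 1 = n - ρ by ring,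
      show (n : ℤ) + 1 - ρ = (n + 1 : ℕ) - (ρ : ℕ) by push_cast; ring, zpow_sub₀ hq,
      zpow_natCast, zpow_natCast] at h1
    rw [show (n : ℤ) + 1 + ρ + 1 - 1 = n + ρ + 1 by ring,
      show (n : ℤ) + 1 + ρ + 1 = (n + 1 + ρ + 1 : ℕ) by push_cast; ring, zpow_natCast] at h2
    simp only [H, baileyTerm]
    rw [show (n : ℤ) + 1 - (ρ + 1 : ℕ) = n - ρ by push_cast; ring,
      show (n : ℤ) + 1 + (ρ + 1 : ℕ) = (n + 1 + ρ + 1 : ℕ) by push_cast; ring,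
      show ((n + 1 : ℕ) : ℤ) + ρ + 1 = (n + 1 + ρ + 1 : ℕ) by push_cast; ring,
      show (n : ℤ) + 1 + ρ = n + ρ + 1 by ring,
      show (n : ℤ) + 1 - ρ = (n + 1 : ℕ) - (ρ : ℕ) by push_cast; ring, h1, h2]
    field_simp
    ring
  have hH0 : H 0 = 0 := by simp [H]
  have hHn : H (n + 2) = 0 := by
    simp only [H]
    rw [recipPoch_of_neg (z := (n : ℤ) + 1 - (n + 2 : ℕ)) (by push_cast; omega)]
    ring
  have hsum := Finset.sum_range_sub H (n + 2)
  rw [← Finset.sum_congr rfl fun ρ _ => key ρ, Finset.sum_sub_distrib, ← Finset.mul_sum,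
    hH0, hHn, sub_zero] at hsum
  rw [sum_baileyTerm_extend (Nat.le_succ n)]
  exact sub_eq_zero.1 hsum

lemma sum_baileyTerm_zero (n : ℕ) :
    ∑ ρ ∈ Finset.range (n + 1), baileyTerm 0 n ρ = (qp (qq ^ 2) (qq ^ 2) n)⁻¹ := by
  induction n with
  | zero =>
    have h := recipPoch_sub_one 1
    have h0 : recipPoch 0 = 1 := by simp [recipPoch, qp]
    rw [sub_self, h0, zpow_one] at h
    simp [baileyTerm, qp, h0, ← h]
  | succ n ih =>
    have h := sum_baileyTerm_zero_succ n
    have hn := one_sub_qq_pow_ne_zero (2 * n + 1)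
    rw [show 2 * n + 1 + 1 = 2 * (n + 1) by ring] at hn
    rw [ih] at h
    rw [qp, Finset.prod_range_succ, ← qp, mul_inv, ← h,
      show qq ^ 2 * (qq ^ 2) ^ n = qq ^ (2 * (n + 1)) by ring]
    field_simp

/-- The multiple sum attached to chains of length `d`, without the factor `(1 + qⁿ) / 2`. -/
def multiSum (d n : ℕ) : F :=
  ∑ N ∈ decTuples d n, qq ^ (∑ i : Fin d, ((N i) ^ 2 + N i)) *
    ((∏ i ∈ Finset.range d, qp qq qq (chain d n N i - chain d n N (i + 1))) *
      qp (qq ^ 2) (qq ^ 2) (chain d n N d))⁻¹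

lemma multiSum_zero (n : ℕ) : multiSum 0 n = (qp (qq ^ 2) (qq ^ 2) n)⁻¹ := by
  have h : decTuples 0 n = Finset.univ := by
    ext N
    simp [decTuples]
  simp [multiSum, h, chain]

lemma mem_decTuples {t b : ℕ} {N : Fin t → ℕ} :
    N ∈ decTuples t b ↔ (∀ i, N i ≤ b) ∧ ∀ i j : Fin t, i ≤ j → N j ≤ N i := by
  simp [decTuples]

lemma cons_mem_decTuples {d n m : ℕ} {N : Fin d → ℕ} :
    (Fin.cons m N : Fin (d + 1) → ℕ) ∈ decTuples (d + 1) n ↔ m ≤ n ∧ N ∈ decTuples d m := by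
  simp only [mem_decTuples, Fin.forall_fin_succ, Fin.cons_zero, Fin.cons_succ,
    Fin.succ_le_succ_iff]
  constructor
  · rintro ⟨⟨hm, -⟩, ⟨-, h0⟩, h⟩
    exact ⟨hm, fun i => h0 i (Fin.zero_le _), fun i => (h i).2⟩
  · rintro ⟨hm, hN, h⟩
    refine ⟨⟨hm, fun i => (hN i).trans hm⟩, ⟨fun _ => le_rfl, fun i _ => hN i⟩, fun i => ⟨?_, h i⟩⟩
    intro hi
    exact absurd hi (by simp)

lemma chain_zero (t n : ℕ) (N : Fin t → ℕ) : chain t n N 0 = n := if_pos rfl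

lemma chain_cons_succ (d n m : ℕ) (N : Fin d → ℕ) (i : ℕ) :
    chain (d + 1) n (Fin.cons m N : Fin (d + 1) → ℕ) (i + 1) = chain d m N i := by
  cases i with
  | zero => simp [chain]
  | succ i =>
    simp only [chain, Nat.add_one_sub_one, Nat.add_lt_add_iff_right, Nat.add_eq_zero_iff,
      one_ne_zero, and_false, if_false]
    split_ifs with h
    · exact Fin.cons_succ (α := fun _ => ℕ) m N ⟨i, h⟩
    · rfl

lemma sum_decTuples_succ (d n : ℕ) (f : (Fin (d + 1) → ℕ) → F) :
    ∑ N ∈ decTuples (d + 1) n, f N =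
      ∑ m ∈ Finset.range (n + 1), ∑ N ∈ decTuples d m, f (Fin.cons m N) := by
  rw [Finset.sum_sigma']
  symm
  refine Finset.sum_bij' (fun x _ => (Fin.cons x.1 x.2 : Fin (d + 1) → ℕ))
    (fun N _ => ⟨N 0, Fin.tail N⟩) ?_ ?_ ?_ ?_ ?_
  · rintro ⟨m, N⟩ h
    simpa [cons_mem_decTuples, Nat.lt_succ_iff] using h
  · intro N h
    rw [← Fin.cons_self_tail N, cons_mem_decTuples] at h
    simpa [Nat.lt_succ_iff] using h
  · rintro ⟨m, N⟩ _
    simp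
  · intro N _
    exact Fin.cons_self_tail N
  · intros
    rfl

lemma multiSum_succ (d n : ℕ) :
    multiSum (d + 1) n =
      ∑ m ∈ Finset.range (n + 1), qq ^ (m ^ 2 + m) * recipPoch (n - m) * multiSum d m := by
  rw [multiSum, sum_decTuples_succ]
  refine Finset.sum_congr rfl fun m hm => ?_
  have hm' : m ≤ n := Nat.lt_succ_iff.1 (Finset.mem_range.1 hm)
  rw [multiSum, Finset.mul_sum]
  refine Finset.sum_congr rfl fun N _ => ?_
  rw [Finset.prod_range_succ', Fin.sum_univ_succ, ← Nat.cast_sub hm', recipPoch_natCast]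
  simp only [chain_cons_succ, chain_zero, Fin.cons_zero, Fin.cons_succ, mul_inv, pow_add]
  ring

lemma multiSum_eq_sum_baileyTerm (d n : ℕ) :
    multiSum d n = ∑ ρ ∈ Finset.range (n + 1), baileyTerm d n ρ := by
  induction d generalizing n with
  | zero => rw [multiSum_zero, sum_baileyTerm_zero]
  | succ d ih => rw [multiSum_succ, ← sum_baileyTerm_succ, Finset.sum_congr rfl fun m _ => by rw [ih]]

/-- Passage from the Bailey pair relative to `(q,q)` to the one relative to `(1,q)`. -/
lemma sum_alpha_eq (d n : ℕ) :
    ∑ ρ ∈ Finset.range (n + 1),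
      (if ρ = 0 then 1 else
        (-1 : F) ^ ρ * qq ^ ((d + 1) * ρ ^ 2) *
          (qq ^ (d * ρ) + qq ^ (-(((d : ℤ) + 1) * (ρ : ℤ)))) * (1 + qq ^ ρ) / 2) *
      (recipPoch (n - ρ) * recipPoch (n + ρ)) =
    (1 + qq ^ n) / 2 * ∑ ρ ∈ Finset.range (n + 1), baileyTerm d n ρ := by
  have hq := qq_ne_zero
  let w : ℕ → F := fun ρ => (-1) ^ ρ * qq ^ ((d + 1) * ρ ^ 2 + d * ρ)
  let A : ℕ → F := fun ρ => w ρ * (1 + qq ^ ρ) / 2 * (recipPoch (n - ρ) * recipPoch (n + ρ))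
  let B : ℕ → F := fun ρ => w ρ * (qq ^ ρ + qq ^ (2 * ρ + 1)) / 2 *
    (recipPoch (n - ρ - 1) * recipPoch (n + ρ + 1))
  have hAB : ∀ ρ, A ρ - B ρ = (1 + qq ^ n) / 2 * baileyTerm d n ρ := by
    intro ρ
    have h1 := recipPoch_sub_one (n - ρ)
    have h2 := recipPoch_sub_one (n + ρ + 1)
    rw [zpow_sub₀ hq, zpow_natCast, zpow_natCast] at h1
    rw [show (n : ℤ) + ρ + 1 - 1 = n + ρ by ring,
      show (n : ℤ) + ρ + 1 = (n + ρ + 1 : ℕ) by push_cast; ring, zpow_natCast] at h2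
    simp only [A, B, w, baileyTerm]
    rw [h1, h2, show (n : ℤ) + ρ + 1 = (n + ρ + 1 : ℕ) by push_cast; ring]
    field_simp
    ring
  have hsucc : ∀ ρ : ℕ, (if ρ + 1 = 0 then 1 else
      (-1 : F) ^ (ρ + 1) * qq ^ ((d + 1) * (ρ + 1) ^ 2) *
        (qq ^ (d * (ρ + 1)) + qq ^ (-(((d : ℤ) + 1) * ((ρ + 1 : ℕ) : ℤ)))) *
          (1 + qq ^ (ρ + 1)) / 2) *
      (recipPoch (n - (ρ + 1 : ℕ)) * recipPoch (n + (ρ + 1 : ℕ))) = A (ρ + 1) - B ρ := by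
    intro ρ
    have hz : qq ^ (-(((d : ℤ) + 1) * ((ρ + 1 : ℕ) : ℤ))) = (qq ^ ((d + 1) * (ρ + 1)))⁻¹ := by
      rw [zpow_neg, ← zpow_natCast]
      push_cast
      rfl
    rw [if_neg (Nat.succ_ne_zero ρ), hz]
    simp only [A, B, w]
    rw [show (n : ℤ) - ρ - 1 = n - (ρ + 1 : ℕ) by push_cast; ring,
      show (n : ℤ) + ρ + 1 = n + (ρ + 1 : ℕ) by push_cast; ring]
    field_simp
    ring
  have hB : B n = 0 := by
    simp only [B]
    rw [recipPoch_of_neg (z := (n : ℤ) - n - 1) (by omega)]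
    ring
  have hA : A 0 = recipPoch n * recipPoch n := by
    have : CharZero F := charZero_of_injective_algebraMap (algebraMap ℚ F).injective
    have h2 : (1 + 1 : F) / 2 = 1 := by norm_num
    simp only [A, w]
    simp [h2]
  rw [Finset.mul_sum, ← Finset.sum_congr rfl fun ρ _ => hAB ρ, Finset.sum_sub_distrib,
    Finset.sum_range_succ', Finset.sum_congr rfl fun ρ _ => hsucc ρ, Finset.sum_sub_distrib,
    Finset.sum_range_succ' A, Finset.sum_range_succ B, hB, hA]
  simp only [if_true, Nat.cast_zero, sub_zero, add_zero, one_mul]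
  ring

/-- Lemma 5.4: a Bailey pair relative to `(1,q)`: here `α_0 = 1`,
`α_n = (-1)ⁿ q^{(k-r)n²} (q^{(k-r-1)n} + q^{-(k-r)n}) (1+qⁿ)/2` for `n ≥ 1`, and
`β_n` is the multiple sum over `n ≥ N_{r+1} ≥ ⋯ ≥ N_{k-1} ≥ 0` of
`(1+qⁿ) q^{ΣNᵢ²+ΣNᵢ} / (2 (q;q)_{n-N_{r+1}} ⋯ (q;q)_{N_{k-2}-N_{k-1}} (q²;q²)_{N_{k-1}})`. -/
theorem statement19 (k r : ℕ) (hr : 1 ≤ r) (hrk : r < k) (n : ℕ) :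
    (∑ N ∈ decTuples (k - 1 - r) n,
      (1 + qq ^ n) * qq ^ (∑ i : Fin (k - 1 - r), ((N i) ^ 2 + N i)) /
        (2 * (∏ i ∈ Finset.range (k - 1 - r),
            qp qq qq (chain (k - 1 - r) n N i - chain (k - 1 - r) n N (i + 1))) *
          qp (qq ^ 2) (qq ^ 2) (chain (k - 1 - r) n N (k - 1 - r)))) =
    ∑ ρ ∈ Finset.range (n + 1),
      (if ρ = 0 then 1 else
        (-1 : F) ^ ρ * qq ^ ((k - r) * ρ ^ 2) *
          (qq ^ ((k - r - 1) * ρ) + qq ^ (-(((k : ℤ) - (r : ℤ)) * (ρ : ℤ)))) *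
          (1 + qq ^ ρ) / 2) /
      (qp qq qq (n - ρ) * qp qq qq (n + ρ)) := by
  obtain ⟨d, rfl⟩ : ∃ d, k = r + (d + 1) := ⟨k - r - 1, by omega⟩
  have hd : r + (d + 1) - 1 - r = d := by omega
  have hd1 : r + (d + 1) - r = d + 1 := by omega
  have hz : ((r + (d + 1) : ℕ) : ℤ) - r = d + 1 := by push_cast; ring
  rw [hd, hd1, hz, Nat.add_sub_cancel]
  calc
    _ = (1 + qq ^ n) / 2 * multiSum d n := by
      rw [multiSum, Finset.mul_sum]
      refine Finset.sum_congr rfl fun N _ => ?_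
      rw [mul_assoc 2, div_eq_mul_inv, mul_inv]
      ring
    _ = _ := by
      rw [multiSum_eq_sum_baileyTerm, ← sum_alpha_eq]
      refine Finset.sum_congr rfl fun ρ hρ => ?_
      have hρ' : ρ ≤ n := Nat.lt_succ_iff.1 (Finset.mem_range.1 hρ)
      rw [← Nat.cast_sub hρ', ← Nat.cast_add, recipPoch_natCast, recipPoch_natCast, ← mul_inv,
        ← div_eq_mul_inv]

end
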